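/- arXiv:1103.0596 — 2 statements merged into one kernel-verified Lean document; each statement's English description precedes it below -/
import Mathlib

section
/- Every finite set of integers in which the absolute difference of any two distinct elements lies in {3, 4, 5, 7, 8, 9} has at most three elements. In particular, the maximum number of tones in a harmonic subset of any scale is three. -/
theorem harmonic_subset_card_le_three (S : Finset ℤ)
    (h : ∀ a ∈ S, ∀ b ∈ S, a ≠ b → |a - b| ∈ ({3, 4, 5, 7, 8, 9} : Finset ℤ)) :
    S.card ≤ 3 := by
  by_contra hc
  obtain ⟨T, hTS, hT⟩ := Finset.exists_subset_card_eq (show 4 ≤ S.card by omega)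
  have key : ∀ i j : Fin 4, i < j →
      T.orderEmbOfFin hT j - T.orderEmbOfFin hT i ∈ ({3, 4, 5, 7, 8, 9} : Finset ℤ) := by
    intro i j hij
    have hlt : T.orderEmbOfFin hT i < T.orderEmbOfFin hT j :=
      (T.orderEmbOfFin hT).strictMono hij
    have := h _ (hTS (T.orderEmbOfFin_mem hT j)) _ (hTS (T.orderEmbOfFin_mem hT i)) hlt.ne'
    rwa [abs_of_pos (sub_pos.2 hlt)] at this
  have h01 := key 0 1 (by decide)
  have h12 := key 1 2 (by decide)
  have h23 := key 2 3 (by decide)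
  have h02 := key 0 2 (by decide)
  have h03 := key 0 3 (by decide)
  simp only [Finset.mem_insert, Finset.mem_singleton] at h01 h12 h23 h02 h03
  generalize T.orderEmbOfFin hT 0 = a at *
  generalize T.orderEmbOfFin hT 1 = b at *
  generalize T.orderEmbOfFin hT 2 = c at *
  generalize T.orderEmbOfFin hT 3 = d at *
  have e1 : 3 ≤ b - a := by omega
  have e2 : 3 ≤ c - b := by omega
  have e3 : 3 ≤ d - c := by omega
  have e4 : d - a ≤ 9 := by omega
  clear h01 h12 h23 h03
  omega
end

section
/- If the interval of 6 semitones is also counted as harmonic (so that the set of harmonic intervals becomes {3, 4, 5, 6, 7, 8, 9}), then every finite set of integers whose pairwise absolute differences all lie in {3, 4, 5, 6, 7, 8, 9} has at most four elements, and the set {1, 4, 7, 10} is such a set with exactly four elements. Hence the maximum size of a harmonic subset under this extended notion is exactly four. -/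
theorem extended_harmonic_subset_max_four :
    (∀ S : Finset ℤ,
        (∀ a ∈ S, ∀ b ∈ S, a ≠ b → |a - b| ∈ ({3, 4, 5, 6, 7, 8, 9} : Finset ℤ)) →
        S.card ≤ 4) ∧
    ((∀ a ∈ ({1, 4, 7, 10} : Finset ℤ), ∀ b ∈ ({1, 4, 7, 10} : Finset ℤ),
        a ≠ b → |a - b| ∈ ({3, 4, 5, 6, 7, 8, 9} : Finset ℤ)) ∧
      ({1, 4, 7, 10} : Finset ℤ).card = 4) := by
  refine ⟨?_, by decide, by decide⟩
  intro S h
  have h' : ∀ a ∈ S, ∀ b ∈ S, a ≠ b → 3 ≤ |a - b| ∧ |a - b| ≤ 9 := by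
    intro a ha b hb hab
    have := h a ha b hb hab
    simp only [Finset.mem_insert, Finset.mem_singleton] at this
    omega
  rcases S.eq_empty_or_nonempty with rfl | hS
  · simp
  obtain ⟨m, hm, hmin⟩ := S.exists_min_image id hS
  simp only [id] at hmin
  have key : S.card ≤ (Finset.Icc (0 : ℤ) 3).card := by
    apply Finset.card_le_card_of_injOn (fun x => (x - m) / 3)
    · intro x hx
      have hx' : x ∈ S := hx
      have h1 := hmin x hx'
      have h2 : x - m ≤ 9 := by
        by_cases e : x = m
        · omega
        · exact (le_abs_self _).trans (h' x hx' m hm e).2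
      simp only [Finset.coe_Icc, Set.mem_Icc]
      omega
    · intro x hx y hy hxy
      by_contra e
      have h3 := (h' x hx y hy e).1
      simp only at hxy
      rcases le_abs.1 h3 with h4 | h4 <;> omega
  simpa using key
end
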